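/- For d ≥ 6, there do not exist almost Moore digraphs of degree d and diameter k with self-repeats whenever either k is odd with k ≥ 2(d−1), or k is even with k ≥ 2(d−1)². -/

import Mathlib

/-- `IsWalkFrom A u v l` : the list `u :: l` is a directed walk from `u` to `v`
along the adjacency relation `A`; the length of the walk is `l.length`. -/
def IsWalkFrom {V : Type} (A : V → V → Prop) (u v : V) (l : List V) : Prop :=
  List.Chain A u l ∧ (u :: l).getLast (List.cons_ne_nil u l) = v

/-- An almost Moore digraph (a `(d,k)`-digraph): a diregular digraph of degree `d > 1`,
diameter `k > 1` and order `d + d² + ⋯ + d^k`, together with its repeat permutation `rep`: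
for every vertex `v`, every vertex `w ≠ rep v` is reached from `v` by exactly one walk of
length at most `k`, while `rep v` is reached by exactly two such walks, at least one of
which has length `k`.  The map `rep` is an automorphism of the digraph. -/
structure AlmostMooreDigraph (d k : ℕ) where
  hd : 1 < d
  hk : 1 < k
  V : Type
  [fintypeV : Fintype V]
  [decEqV : DecidableEq V]
  Adj : V → V → Prop
  [adjDec : DecidableRel Adj]
  loopless : ∀ v, ¬ Adj v v
  out_deg : ∀ v, {w | Adj v w}.ncard = d
  in_deg : ∀ v, {w | Adj w v}.ncard = d
  reach : ∀ u v, ∃ l, IsWalkFrom Adj u v l ∧ l.length ≤ k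
  diam : ∃ u v, ∀ l, IsWalkFrom Adj u v l → k ≤ l.length
  card_eq : Fintype.card V = ∑ i ∈ Finset.range k, d ^ (i + 1)
  rep : V → V
  rep_spec : ∀ v w, w ≠ rep v → ∃! l, IsWalkFrom Adj v w l ∧ l.length ≤ k
  rep_two : ∀ v, ∃ l₁ l₂, l₁ ≠ l₂ ∧
      IsWalkFrom Adj v (rep v) l₁ ∧ l₁.length ≤ k ∧
      IsWalkFrom Adj v (rep v) l₂ ∧ l₂.length ≤ k ∧
      (l₁.length = k ∨ l₂.length = k) ∧
      (∀ l, IsWalkFrom Adj v (rep v) l → l.length ≤ k → l = l₁ ∨ l = l₂)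
  rep_bijective : Function.Bijective rep
  rep_adj : ∀ u v, Adj u v ↔ Adj (rep u) (rep v)

attribute [instance] AlmostMooreDigraph.fintypeV AlmostMooreDigraph.decEqV
  AlmostMooreDigraph.adjDec

/-- `ordRep M v` : the smallest `t ≥ 1` with `rep^t v = v`. -/
noncomputable def ordRep {d k : ℕ} (M : AlmostMooreDigraph d k) (v : M.V) : ℕ :=
  sInf {t | 0 < t ∧ M.rep^[t] v = v}

/-- The vertex set of the subdigraph `H_α`: vertices whose order under the repeat
permutation divides `2^t * α` for some `t ≥ 0`. -/
def Hset {d k : ℕ} (M : AlmostMooreDigraph d k) (α : ℕ) : Set M.V :=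
  {v | ∃ t : ℕ, ordRep M v ∣ 2 ^ t * α}

open Finset Matrix

theorem Matrix.mul_apply_pos {S : Type*} [Fintype S] {M N : Matrix S S ℤ}
    (hM : ∀ u w, 0 ≤ M u w) (hN : ∀ u w, 0 ≤ N u w) {u x w : S} (h₁ : 0 < M u x)
    (h₂ : 0 < N x w) : 0 < (M * N) u w := by
  rw [Matrix.mul_apply]
  exact Finset.sum_pos' (fun y _ => mul_nonneg (hM u y) (hN y w))
    ⟨x, Finset.mem_univ x, mul_pos h₁ h₂⟩

theorem Matrix.pow_apply_self_pos {S : Type*} [Fintype S] [DecidableEq S] {M : Matrix S S ℤ}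
    (hM : ∀ u w, 0 ≤ M u w) {u : S} (h : 0 < M u u) (i : ℕ) : 0 < (M ^ i) u u := by
  induction i with
  | zero => simp
  | succ i ih =>
    rw [pow_succ]
    exact mul_apply_pos (pow_apply_nonneg hM i) hM ih h

/-- If `P ^ n = 1`, `A` commutes with `P` and the diagonal of `A ^ (l * n)` vanishes, then
`A ^ l * (1 + P + ⋯ + P ^ (n - 1))` is traceless. -/
theorem Matrix.trace_pow_mul_geom_sum_eq_zero {S : Type*} [Fintype S] [DecidableEq S]
    {A P : Matrix S S ℤ} (hA : ∀ u w, 0 ≤ A u w) (hP : ∀ u w, 0 ≤ P u w) {n l : ℕ}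
    (hPn : P ^ n = 1) (hAP : Commute A P) (hdiag : ∀ u, (A ^ (l * n)) u u = 0) :
    (A ^ l * ∑ j ∈ range n, P ^ j).trace = 0 := by
  rw [Finset.mul_sum, Matrix.trace_sum]
  refine Finset.sum_eq_zero fun j _ => Finset.sum_eq_zero fun u _ => ?_
  have hnn : ∀ u w, 0 ≤ (A ^ l * P ^ j) u w := fun u w => by
    rw [Matrix.mul_apply]
    exact Finset.sum_nonneg fun x _ =>
      mul_nonneg (pow_apply_nonneg hA l u x) (pow_apply_nonneg hP j x w)
  by_contra hne
  have h := pow_apply_self_pos hnn (lt_of_le_of_ne (hnn u u) (Ne.symm hne)) n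
  rw [(hAP.pow_pow l j).mul_pow, ← pow_mul, ← pow_mul, mul_comm j n, pow_mul P, hPn, one_pow,
    mul_one, hdiag u] at h
  exact lt_irrefl 0 h

/-- For `Q` commuting with `B` and `Q ^ 2 = n Q`, the trace of `B ^ q * Q` vanishes modulo a prime
`q ∤ n` as soon as `B * Q` is traceless. -/
theorem Matrix.prime_dvd_trace_pow_mul {S : Type*} [Fintype S] [DecidableEq S]
    {B Q : Matrix S S ℤ} {n : ℕ} (hBQ : Commute B Q) (hQ : Q * Q = (n : ℤ) • Q) {q : ℕ}
    (hq : q.Prime) (hqn : ¬ q ∣ n) (h : (B * Q).trace = 0) :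
    (q : ℤ) ∣ (B ^ q * Q).trace := by
  have : Fact q.Prime := ⟨hq⟩
  have hQpow : ∀ i : ℕ, Q ^ (i + 1) = ((n : ℤ) ^ i) • Q := fun i => by
    induction i with
    | zero => simp
    | succ i ih => rw [pow_succ, ih, smul_mul_assoc, hQ, smul_smul, pow_succ]
  obtain ⟨m, rfl⟩ : ∃ m, q = m + 1 := ⟨q - 1, by have := hq.pos; omega⟩
  have h1 : (((B * Q) ^ (m + 1)).trace : ZMod (m + 1)) = 0 := by
    have := ZMod.trace_pow_card (p := m + 1) ((B * Q).map (Int.castRingHom (ZMod (m + 1))))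
    rw [← Matrix.map_pow] at this
    have hc : ∀ M : Matrix S S ℤ, (M.map (Int.castRingHom (ZMod (m + 1)))).trace
        = ((M.trace : ℤ) : ZMod (m + 1)) := fun M => by
      simp [Matrix.trace]
    rw [hc, hc, h] at this
    simpa using this
  rw [hBQ.mul_pow, hQpow, mul_smul_comm, Matrix.trace_smul, smul_eq_mul,
    ZMod.intCast_zmod_eq_zero_iff_dvd] at h1
  have hp : Prime ((m + 1 : ℕ) : ℤ) := Nat.prime_iff_prime_int.mp hq
  rcases hp.dvd_or_dvd h1 with h2 | h2
  · exact absurd (Int.natCast_dvd_natCast.mp (hp.dvd_of_dvd_pow h2)) hqn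
  · exact h2

/-- A periodicity of traces, for a matrix `A` whose powers `1, A, ⋯, A ^ k` sum up
to `J + P`. -/
theorem Matrix.trace_pow_add_mul {S : Type*} [Fintype S] [DecidableEq S]
    {A P Q J : Matrix S S ℤ} {n k : ℕ} {δ N : ℤ} (hsum : ∑ i ∈ range (k + 1), A ^ i = J + P)
    (hPQ : P * Q = Q) (hJQ : J * Q = (n : ℤ) • J) (hAJ : A * J = δ • J)
    (hN : N * (δ - 1) = δ ^ (k + 1) - δ) (hJ : J.trace = N) (j i : ℕ) :
    (A ^ (j + 1 + i * k) * Q).trace - n * δ ^ (j + 1 + i * k)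
      = (A ^ (j + 1) * Q).trace - n * δ ^ (j + 1) := by
  have hAJpow : ∀ j : ℕ, A ^ j * J = δ ^ j • J := fun j => by
    induction j with
    | zero => simp
    | succ j ih => rw [pow_succ', mul_assoc, ih, mul_smul_comm, hAJ, smul_smul, pow_succ]
  have hstep : A ^ (k + 1) * Q - A * Q = (n * (δ - 1)) • J := by
    have hg : A ^ (k + 1) - 1 = (A - 1) * (J + P) := by
      rw [← hsum, mul_geom_sum]
    have : A ^ (k + 1) * Q - A * Q = (A - 1) * (J * Q) + (A - 1) * (P * Q) - (A - 1) * Q := by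
      have : A ^ (k + 1) * Q - A * Q = (A ^ (k + 1) - 1) * Q - (A - 1) * Q := by noncomm_ring
      rw [this, hg]; noncomm_ring
    rw [this, hPQ, hJQ, add_sub_cancel_right, mul_smul_comm, sub_mul, hAJ, one_mul]
    module
  have hone : ∀ j : ℕ, (A ^ (j + 1 + k) * Q).trace - n * δ ^ (j + 1 + k)
      = (A ^ (j + 1) * Q).trace - n * δ ^ (j + 1) := fun j => by
    have h1 : A ^ (j + 1 + k) * Q - A ^ (j + 1) * Q = (n * (δ - 1) * δ ^ j) • J := by
      have : A ^ (j + 1 + k) * Q - A ^ (j + 1) * Q = A ^ j * (A ^ (k + 1) * Q - A * Q) := by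
        rw [mul_sub, ← mul_assoc, ← mul_assoc, ← pow_add, ← pow_succ]
        congr 3; ring
      rw [this, hstep, mul_smul_comm, hAJpow, smul_smul]
    have h2 := congrArg Matrix.trace h1
    rw [Matrix.trace_sub, Matrix.trace_smul, hJ, smul_eq_mul] at h2
    have h3 : (n : ℤ) * (δ - 1) * δ ^ j * N = n * (δ ^ (j + 1 + k) - δ ^ (j + 1)) := by
      calc (n : ℤ) * (δ - 1) * δ ^ j * N = n * δ ^ j * (N * (δ - 1)) := by ring
        _ = _ := by rw [hN]; ring
    linarith
  induction i with
  | zero => simp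
  | succ i ih =>
    rw [← ih]
    have e1 : j + 1 + (i + 1) * k = j + i * k + 1 + k := by ring
    have e2 : j + 1 + i * k = j + i * k + 1 := by ring
    rw [e1, e2, hone (j + i * k)]

/-- Let `A` be an integer matrix commuting with a matrix `P` of finite order `n`,
whose powers `1, A, ⋯, A ^ k` sum up to `J + P`, `J` being the all-ones matrix. Then
`A ^ l * Q` and `A ^ (l * s) * Q`, with `Q = 1 + P + ⋯ + P ^ (n - 1)`, are not both traceless if
`l ∣ k` and `s` is coprime to `k / l`. -/
theorem Matrix.not_trace_eq_zero_of_coprime {S : Type*} [Fintype S] [DecidableEq S] [Nonempty S]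
    {A P : Matrix S S ℤ} {n k δ l s : ℕ} (hn : 0 < n) (hk : 0 < k) (hPn : P ^ n = 1)
    (hAP : Commute A P)
    (hsum : ∑ i ∈ range (k + 1), A ^ i = Matrix.of (fun _ _ => 1) + P)
    (hAJ : A * Matrix.of (fun _ _ => 1) = (δ : ℤ) • Matrix.of (fun _ _ => 1))
    (hPJ : P * Matrix.of (fun _ _ => 1) = Matrix.of (fun _ _ => 1))
    (hJP : Matrix.of (fun _ _ => 1) * P = Matrix.of (fun _ _ => 1))
    (hδ : 2 ≤ δ) (hs : 2 ≤ s) (hlk : l ∣ k) (hcop : s.Coprime (k / l))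
    (h₁ : (A ^ l * ∑ j ∈ range n, P ^ j).trace = 0)
    (h₂ : (A ^ (l * s) * ∑ j ∈ range n, P ^ j).trace = 0) : False := by
  set J : Matrix S S ℤ := Matrix.of (fun _ _ => 1) with hJdef
  set Q := ∑ j ∈ range n, P ^ j with hQdef
  have hPQ : P * Q = Q := by
    have := mul_geom_sum P n
    rwa [hPn, sub_self, sub_mul, one_mul, sub_eq_zero] at this
  have hPpowQ : ∀ j, P ^ j * Q = Q := fun j => by
    induction j with
    | zero => simp
    | succ j ih => rw [pow_succ, mul_assoc, hPQ, ih]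
  have hQQ : Q * Q = (n : ℤ) • Q := by
    conv_lhs => rw [hQdef, ← hQdef, Finset.sum_mul]
    simp [hPpowQ]
  have hJPpow : ∀ j, J * P ^ j = J := fun j => by
    induction j with
    | zero => simp
    | succ j ih => rw [pow_succ, ← mul_assoc, ih, hJP]
  have hJQ : J * Q = (n : ℤ) • J := by
    rw [hQdef, Finset.mul_sum]
    simp [hJPpow]
  have hAQ : Commute A Q := Commute.sum_right _ _ _ fun j _ => hAP.pow_right j
  have hAJpow : ∀ j : ℕ, A ^ j * J = (δ : ℤ) ^ j • J := fun j => by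
    induction j with
    | zero => simp
    | succ j ih => rw [pow_succ', mul_assoc, ih, mul_smul_comm, hAJ, smul_smul, pow_succ]
  have hN : (Fintype.card S : ℤ) * ((δ : ℤ) - 1) = (δ : ℤ) ^ (k + 1) - δ := by
    have h := congrArg (fun M => M * J) hsum
    simp only [Finset.sum_mul, hAJpow, add_mul, hPJ, ← Finset.sum_smul] at h
    obtain ⟨u⟩ := ‹Nonempty S›
    have h' := congrFun (congrFun h u) u
    simp [hJdef, Matrix.mul_apply] at h'
    have := geom_sum_mul (δ : ℤ) (k + 1)
    rw [h'] at this
    linarith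
  have hJtr : J.trace = Fintype.card S := by simp [hJdef, Matrix.trace]
  have hl : 0 < l := Nat.pos_of_dvd_of_pos hlk hk
  obtain ⟨c, rfl⟩ := hlk
  rw [Nat.mul_div_cancel_left _ hl] at hcop
  have hc : c ≠ 0 := by rintro rfl; simp at hk
  obtain ⟨q, hqgt, hq, hqs⟩ :=
    Nat.forall_exists_prime_gt_and_modEq (n + s + δ ^ (l * s)) hc hcop
  have hlt : l < l * s := by nlinarith
  obtain ⟨i, hi⟩ : ∃ i, q = s + c * i := by
    obtain ⟨i, hi⟩ := (Nat.modEq_iff_dvd' (by omega)).mp hqs.symm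
    exact ⟨i, by omega⟩
  have hdvd : (q : ℤ) ∣ (A ^ (l * q) * Q).trace := by
    rw [pow_mul]
    refine prime_dvd_trace_pow_mul (hAQ.pow_left l) hQQ hq (fun hd => ?_) h₁
    have := Nat.le_of_dvd hn hd
    omega
  obtain ⟨j, hj⟩ : ∃ j, l * s = j + 1 := ⟨l * s - 1, by omega⟩
  have hper := trace_pow_add_mul hsum hPQ hJQ hAJ hN hJtr j i
  have e : j + 1 + i * (l * c) = l * q := by rw [← hj, hi]; ring
  rw [e, ← hj, h₂] at hper
  have hdvd2 : (q : ℤ) ∣ n * ((δ : ℤ) ^ (l * q) - (δ : ℤ) ^ (l * s)) := by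
    have : (n : ℤ) * ((δ : ℤ) ^ (l * q) - (δ : ℤ) ^ (l * s)) = (A ^ (l * q) * Q).trace := by
      linarith
    rwa [this]
  have hqp : Prime (q : ℤ) := Nat.prime_iff_prime_int.mp hq
  have hdvd3 : (q : ℤ) ∣ (δ : ℤ) ^ (l * q) - (δ : ℤ) ^ (l * s) := by
    refine (hqp.dvd_or_dvd hdvd2).resolve_left fun h => ?_
    have := Nat.le_of_dvd hn (Int.natCast_dvd_natCast.mp h)
    omega
  have : Fact q.Prime := ⟨hq⟩
  have hfermat : (q : ℤ) ∣ (δ : ℤ) ^ (l * q) - (δ : ℤ) ^ l := by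
    rw [← ZMod.intCast_zmod_eq_zero_iff_dvd]
    push_cast
    rw [pow_mul, ZMod.pow_card, sub_self]
  have hdvd4 : (q : ℤ) ∣ (δ : ℤ) ^ (l * s) - (δ : ℤ) ^ l := by
    have := dvd_sub hfermat hdvd3
    simpa using this
  have hpow : (δ : ℤ) ^ l < (δ : ℤ) ^ (l * s) := pow_lt_pow_right₀ (by exact_mod_cast hδ) hlt
  have hle := Int.le_of_dvd (by linarith) hdvd4
  have hq' : ((δ : ℤ) ^ (l * s)) < q := by
    have : δ ^ (l * s) < q := by omega
    exact_mod_cast this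
  have : (0 : ℤ) < (δ : ℤ) ^ l := by positivity
  linarith

/-- Let `A` be a nonnegative matrix invariant under a permutation `σ`, without closed walks of
length two. If the powers `1, A, ⋯, A ^ k` sum up to a matrix with entries `1`, except for the
entries `(u, σ u)`, where `0` and `2` are allowed, then `A` has constant row sums,
and each entry `(u, σ u)` is `2` as soon as one is, at a point from which all others are reached. -/
theorem Matrix.exists_regular_of_sum_pow {S : Type*} [Fintype S] [DecidableEq S]
    {A : Matrix S S ℤ} {σ : Equiv.Perm S} {k : ℕ} {v₀ : S}
    (hA : ∀ u w, 0 ≤ A u w) (hAσ : ∀ u w, A (σ u) (σ w) = A u w)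
    (hone : ∀ u w, w ≠ σ u → (∑ i ∈ range (k + 1), A ^ i) u w = 1)
    (hrep : ∀ u, (∑ i ∈ range (k + 1), A ^ i) u (σ u) = 0 ∨
      (∑ i ∈ range (k + 1), A ^ i) u (σ u) = 2)
    (hloop : ∀ u, A u u = 0) (htwo : ∀ u, (A ^ 2) u u = 0) (hv₀ : σ v₀ = v₀) :
    (∀ u, ∑ w, A u w = ∑ w, A v₀ w) ∧
      ∑ i ∈ range (k + 1), A ^ i = Matrix.of (fun _ _ => 1) + σ.permMatrix ℤ := by
  set W := ∑ i ∈ range (k + 1), A ^ i with hWdef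
  set ε : S → ℤ := fun u => W u (σ u) - 1 with hε
  have hW : ∀ u w, W u w = 1 + if w = σ u then ε u else 0 := fun u w => by
    split_ifs with h
    · simp [hε, h]
    · simp [hone u w h]
  have hcomm : A * W = W * A :=
    (Commute.sum_right _ _ _ fun i _ => (Commute.refl A).pow_right i)
  have hin : ∀ x, ∑ y, A y (σ x) = ∑ y, A y x := fun x => by
    rw [← Equiv.sum_comp σ]
    simp [hAσ]
  have hkey : ∀ u x, ∑ y, A u y - ∑ y, A y x = A u x * (ε u - ε x) := fun u x => by
    have h := congrFun (congrFun hcomm u) (σ x)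
    simp only [Matrix.mul_apply, hW, mul_add, add_mul, mul_one, one_mul, Finset.sum_add_distrib,
      EmbeddingLike.apply_eq_iff_eq, mul_ite, mul_zero, ite_mul, zero_mul, Finset.sum_ite_eq,
      Finset.sum_ite_eq', Finset.mem_univ, if_true, hin, hAσ] at h
    linarith
  have hio : ∀ u, ∑ y, A u y = ∑ y, A y u := fun u => by
    have := hkey u u
    rw [hloop, zero_mul] at this
    linarith
  have hedge : ∀ u x, A u x * (ε u - ε x) = 0 := fun u x => by
    have h1 := hkey u x
    have h2 := hkey x u
    rw [← hio] at h1 h2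
    have h3 : A u x * A x u = 0 := by
      refine le_antisymm ?_ (mul_nonneg (hA u x) (hA x u))
      rw [← htwo u, pow_two, Matrix.mul_apply]
      exact Finset.single_le_sum (f := fun y => A u y * A y u)
        (fun y _ => mul_nonneg (hA u y) (hA y u)) (Finset.mem_univ x)
    have h4 : A u x * (ε u - ε x) = A x u * (ε u - ε x) := by linarith
    rcases mul_eq_zero.mp h3 with h | h
    · rw [h, zero_mul]
    · rw [h4, h, zero_mul]
  have hdeg : ∀ u, ∑ w, A u w = ∑ w, A v₀ w := fun u => by
    have := hkey u v₀
    rw [hedge, ← hio] at this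
    linarith
  refine ⟨hdeg, ?_⟩
  have hεv₀ : ε v₀ = 1 := by
    have h : (1 : ℤ) ≤ W v₀ v₀ := by
      rw [hWdef, Matrix.sum_apply]
      calc (1 : ℤ) = (A ^ 0) v₀ v₀ := by simp
        _ ≤ _ := Finset.single_le_sum (f := fun i => (A ^ i) v₀ v₀)
          (fun i _ => Matrix.pow_apply_nonneg hA i v₀ v₀) (by simp)
    have h2 := hrep v₀
    simp only [hε]
    rw [hv₀] at h2 ⊢
    omega
  have hreach : ∀ i w, (A ^ i) v₀ w ≠ 0 → ε w = 1 := fun i => by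
    induction i with
    | zero =>
      intro w h
      rw [pow_zero, Matrix.one_apply] at h
      split_ifs at h with hw
      · rw [← hw, hεv₀]
      · exact absurd rfl h
    | succ i ih =>
      intro w h
      rw [pow_succ, Matrix.mul_apply] at h
      obtain ⟨x, -, hx⟩ := Finset.exists_ne_zero_of_sum_ne_zero h
      have h1 := ih x (left_ne_zero_of_mul hx)
      have h2 := (mul_eq_zero.mp (hedge x w)).resolve_left (right_ne_zero_of_mul hx)
      linarith
  have hεone : ∀ w, ε w = 1 := fun w => by
    by_cases hw : w = v₀
    · rw [hw, hεv₀]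
    · have h := hone v₀ w (by rwa [hv₀])
      rw [hWdef, Matrix.sum_apply] at h
      obtain ⟨i, -, hi⟩ := Finset.exists_ne_zero_of_sum_ne_zero (h ▸ one_ne_zero)
      exact hreach i w hi
  ext u w
  rw [hW, hεone]
  simp [Equiv.toPEquiv_apply, PEquiv.toMatrix_apply, eq_comm]

/-- Nonexistence of nonnegative matrices with constraints on the sum of powers and on the
closed walks, invariant under a permutation of order small with respect to `k`. -/
theorem Matrix.not_sum_pow_of_coprime {S : Type*} [Fintype S] [DecidableEq S]
    {A : Matrix S S ℤ} {σ : Equiv.Perm S} {n k l s : ℕ} {v₀ : S} (hn : 0 < n) (hk : 3 ≤ k)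
    (hσn : σ ^ n = 1)
    (hA : ∀ u w, 0 ≤ A u w) (hAσ : ∀ u w, A (σ u) (σ w) = A u w)
    (hone : ∀ u w, w ≠ σ u → (∑ i ∈ range (k + 1), A ^ i) u w = 1)
    (hrep : ∀ u, (∑ i ∈ range (k + 1), A ^ i) u (σ u) = 0 ∨
      (∑ i ∈ range (k + 1), A ^ i) u (σ u) = 2)
    (hgirth : ∀ i, 0 < i → i < k → ∀ u, (A ^ i) u u = 0) (hv₀ : σ v₀ = v₀)
    (hdeg : 2 ≤ ∑ w, A v₀ w) (hs : 2 ≤ s) (hlk : l ∣ k) (hcop : s.Coprime (k / l))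
    (hlt : l * s * n < k) : False := by
  obtain ⟨hreg, hsum⟩ := exists_regular_of_sum_pow hA hAσ hone hrep
    (fun u => by simpa using hgirth 1 one_pos (by omega) u)
    (hgirth 2 two_pos (by omega)) hv₀
  have hl : 0 < l := Nat.pos_of_dvd_of_pos hlk (by omega)
  set P : Matrix S S ℤ := σ.permMatrix ℤ with hPdef
  have hPapply : ∀ u w, P u w = if σ u = w then 1 else 0 := fun u w => by
    simp [hPdef, Equiv.toPEquiv_apply, PEquiv.toMatrix_apply, eq_comm]
  have hP : ∀ u w, 0 ≤ P u w := fun u w => by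
    rw [hPapply]; split_ifs <;> simp
  have hPpow : ∀ i : ℕ, P ^ i = (σ ^ i).permMatrix ℤ := fun i => by
    induction i with
    | zero => simp
    | succ i ih => rw [pow_succ', ih, pow_succ, Matrix.permMatrix_mul]
  have hPn : P ^ n = 1 := by rw [hPpow, hσn, Matrix.permMatrix_one]
  have hAP : Commute A P := by
    ext u w
    rw [Matrix.mul_apply, Matrix.mul_apply]
    obtain ⟨x, rfl⟩ := σ.surjective w
    simp [hPapply, hAσ]
  have : Nonempty S := ⟨v₀⟩
  obtain ⟨δ, hδ⟩ : ∃ δ : ℕ, ∑ w, A v₀ w = δ := ⟨_, (Int.toNat_of_nonneg (by omega)).symm⟩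
  have hsn : l * s * n = l * n * s := by ring
  have hln : 0 < l * n := by positivity
  refine not_trace_eq_zero_of_coprime (δ := δ) hn (by omega) hPn hAP hsum ?_ ?_ ?_ (by omega) hs
    hlk hcop
    (trace_pow_mul_geom_sum_eq_zero hA hP hPn hAP (hgirth _ hln (by nlinarith)))
    (trace_pow_mul_geom_sum_eq_zero hA hP hPn hAP (hgirth _ (by positivity) hlt))
  · ext u w
    simp [Matrix.mul_apply, hreg, hδ]
  · ext u w
    simp [Matrix.mul_apply, hPapply]
  · ext u w
    obtain ⟨x, rfl⟩ := σ.surjective w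
    simp [Matrix.mul_apply, hPapply]

theorem exists_dvd_coprime_mul_lt {d k n : ℕ} (hd : 6 ≤ d)
    (h : (Odd k ∧ 2 * (d - 1) ≤ k) ∨ (Even k ∧ 2 * (d - 1) ^ 2 ≤ k)) (hn : n ≤ d - 1) :
    ∃ l s, 2 ≤ s ∧ l ∣ k ∧ s.Coprime (k / l) ∧ l * s * n < k := by
  rcases h with ⟨hodd, hk⟩ | ⟨-, hk⟩
  · refine ⟨1, 2, le_rfl, one_dvd k, ?_, ?_⟩
    · rwa [Nat.div_one, Nat.coprime_two_left]
    · have : k ≠ 2 * (d - 1) := fun h => by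
        rw [h] at hodd
        exact Nat.not_odd_iff_even.mpr (even_two_mul _) hodd
      omega
  · obtain ⟨e, rfl⟩ : ∃ e, d = e + 1 := ⟨d - 1, by omega⟩
    simp only [Nat.add_sub_cancel] at hk hn
    have hkpos : k ≠ 0 := by rintro rfl; nlinarith
    have hn2 : n ^ 2 ≤ e ^ 2 := Nat.pow_le_pow_left hn 2
    by_cases h5 : 5 ∣ k
    · by_contra! hcon
      have h2 := hcon (ordProj[2] k) 2 le_rfl (Nat.ordProj_dvd k 2)
        (Nat.coprime_ordCompl Nat.prime_two hkpos)
      have h3 := hcon (ordProj[3] k) 3 (by norm_num) (Nat.ordProj_dvd k 3)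
        (Nat.coprime_ordCompl Nat.prime_three hkpos)
      have hdvd : ordProj[2] k * (ordProj[3] k * 5) ∣ k := by
        refine Nat.Coprime.mul_dvd_of_dvd_of_dvd ?_ (Nat.ordProj_dvd k 2) ?_
        · exact Nat.Coprime.pow_left _ (Nat.Coprime.mul_right
            (Nat.Coprime.pow_right _ (by norm_num)) (by norm_num))
        · exact Nat.Coprime.mul_dvd_of_dvd_of_dvd (Nat.Coprime.pow_left _ (by norm_num))
            (Nat.ordProj_dvd k 3) h5
      have hle := Nat.le_of_dvd (Nat.pos_of_ne_zero hkpos) hdvd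
      set a := ordProj[2] k
      set b := ordProj[3] k
      have hmul : k * k ≤ (a * 2 * n) * (b * 3 * n) := Nat.mul_le_mul h2 h3
      have h6 : 5 * (k * k) ≤ 6 * n ^ 2 * k := by
        calc 5 * (k * k) ≤ 5 * ((a * 2 * n) * (b * 3 * n)) := Nat.mul_le_mul_left 5 hmul
          _ = 6 * n ^ 2 * (a * (b * 5)) := by ring
          _ ≤ _ := Nat.mul_le_mul_left _ hle
      have h7 : 5 * k ≤ 6 * n ^ 2 := by
        refine Nat.le_of_mul_le_mul_right ?_ (Nat.pos_of_ne_zero hkpos)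
        rwa [mul_assoc]
      nlinarith
    · refine ⟨1, 5, by norm_num, one_dvd k, ?_, ?_⟩
      · rw [Nat.div_one]
        exact (Nat.Prime.coprime_iff_not_dvd Nat.prime_five).mpr h5
      · nlinarith

theorem isWalkFrom_nil {V : Type} {A : V → V → Prop} {u w : V} :
    IsWalkFrom A u w [] ↔ u = w := by
  simp [IsWalkFrom, List.Chain]

theorem isWalkFrom_cons {V : Type} {A : V → V → Prop} {u w x : V} {l : List V} :
    IsWalkFrom A u w (x :: l) ↔ A u x ∧ IsWalkFrom A x w l := by
  simp [IsWalkFrom, List.Chain, and_assoc]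

theorem isWalkFrom_map {V V' : Type} {A : V → V → Prop} {A' : V' → V' → Prop} {f : V → V'}
    (hf : Function.Injective f) (hA : ∀ u w, A' (f u) (f w) ↔ A u w) {u w : V} {l : List V} :
    IsWalkFrom A' (f u) (f w) (l.map f) ↔ IsWalkFrom A u w l := by
  induction l generalizing u with
  | nil => simp [isWalkFrom_nil, hf.eq_iff]
  | cons x l ih => simp [isWalkFrom_cons, hA, ih]

/-- The powers of the adjacency matrix count the walks of given length. -/
theorem exists_finset_walk_length_eq {V : Type} [Fintype V] [DecidableEq V] (A : V → V → Prop)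
    [DecidableRel A] (i : ℕ) (u w : V) :
    ∃ F : Finset (List V), (∀ l, l ∈ F ↔ IsWalkFrom A u w l ∧ l.length = i) ∧
      (F.card : ℤ) = ((Matrix.of fun u w => if A u w then (1 : ℤ) else 0) ^ i) u w := by
  induction i generalizing u with
  | zero =>
    by_cases h : u = w
    · refine ⟨{[]}, fun l => ?_, by simp [h]⟩
      rw [List.length_eq_zero_iff, Finset.mem_singleton]
      exact ⟨fun hl => ⟨by rw [hl, isWalkFrom_nil, h], hl⟩, fun hl => hl.2⟩
    · refine ⟨∅, fun l => ?_, by simp [h]⟩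
      rw [List.length_eq_zero_iff]
      simp only [Finset.notMem_empty, false_iff, not_and]
      rintro hl rfl
      exact h (isWalkFrom_nil.mp hl)
  | succ i ih =>
    choose F hF hcard using ih
    refine ⟨(Finset.univ.filter (A u)).biUnion fun x => (F x).image (List.cons x),
      fun l => ?_, ?_⟩
    · simp only [Finset.mem_biUnion, Finset.mem_filter, Finset.mem_univ, true_and,
        Finset.mem_image, hF]
      constructor
      · rintro ⟨x, hx, m, ⟨hm, hlen⟩, rfl⟩
        exact ⟨isWalkFrom_cons.mpr ⟨hx, hm⟩, by simp [hlen]⟩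
      · rintro ⟨hl, hlen⟩
        cases l with
        | nil => simp at hlen
        | cons x m =>
          obtain ⟨hx, hm⟩ := isWalkFrom_cons.mp hl
          exact ⟨x, hx, m, ⟨hm, by simpa using hlen⟩, rfl⟩
    · rw [Finset.card_biUnion]
      · rw [pow_succ', Matrix.mul_apply]
        simp only [Finset.card_image_of_injective _ List.cons_injective, Nat.cast_sum, Nat.cast_ite,
          Nat.cast_zero, hcard,
          Matrix.of_apply, ite_mul, one_mul, zero_mul,
          Finset.sum_filter]
      · intro x _ y _ hxy
        rw [Function.onFun, Finset.disjoint_left]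
        rintro l hl hl'
        obtain ⟨m, -, rfl⟩ := Finset.mem_image.mp hl
        obtain ⟨m', -, h⟩ := Finset.mem_image.mp hl'
        exact hxy (List.cons.inj h).1.symm

theorem exists_finset_walk_length_le {V : Type} [Fintype V] [DecidableEq V] (A : V → V → Prop)
    [DecidableRel A] (k : ℕ) (u w : V) :
    ∃ F : Finset (List V), (∀ l, l ∈ F ↔ IsWalkFrom A u w l ∧ l.length ≤ k) ∧
      (F.card : ℤ) =
        (∑ i ∈ range (k + 1), (Matrix.of fun u w => if A u w then (1 : ℤ) else 0) ^ i) u w := by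
  choose F hF hcard using fun i => exists_finset_walk_length_eq A i u w
  refine ⟨(range (k + 1)).biUnion F, fun l => ?_, ?_⟩
  · simp only [Finset.mem_biUnion, Finset.mem_range, hF, Nat.lt_succ_iff]
    exact ⟨fun ⟨i, hi, hl, hlen⟩ => ⟨hl, hlen ▸ hi⟩, fun ⟨hl, hlen⟩ => ⟨_, hlen, hl, rfl⟩⟩
  · rw [Finset.card_biUnion]
    · simp [Matrix.sum_apply, hcard]
    · intro i _ j _ hij
      rw [Function.onFun, Finset.disjoint_left]
      intro l hl hl'
      exact hij (((hF i l).mp hl).2.symm.trans ((hF j l).mp hl').2)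

theorem List.exists_map_val_of_map_eq_self {V : Type*} {g : V → V} {l : List V}
    (h : l.map g = l) : ∃ m : List {v // g v = v}, m.map Subtype.val = l := by
  have hl : ∀ x ∈ l, g x = x := List.map_inj_left.mp (h.trans (List.map_id l).symm)
  lift l to List {v // g v = v} using hl
  exact ⟨l, rfl⟩

theorem List.map_map_val_fixed {V : Type*} {g : V → V} (m : List {v // g v = v}) :
    (m.map Subtype.val).map g = m.map Subtype.val := by
  rw [List.map_map]
  exact List.map_congr_left fun x _ => x.2

namespace AlmostMooreDigraph

variable {d k : ℕ} (M : AlmostMooreDigraph d k)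

theorem length_eq_of_closed_walk {v : M.V} {l : List M.V} (hl : IsWalkFrom M.Adj v v l)
    (hpos : l ≠ []) (hlen : l.length ≤ k) : l.length = k ∧ M.rep v = v := by
  have hnil : IsWalkFrom M.Adj v v [] := isWalkFrom_nil.mpr rfl
  have hrep : M.rep v = v := by
    by_contra hne
    exact hpos ((M.rep_spec v v (Ne.symm hne)).unique ⟨hl, hlen⟩ ⟨hnil, Nat.zero_le k⟩)
  obtain ⟨l₁, l₂, -, -, -, -, -, hk, hall⟩ := M.rep_two v
  rw [hrep] at hall
  have hkpos : 0 < k := lt_trans one_pos M.hk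
  refine ⟨?_, hrep⟩
  rcases hall [] hnil (Nat.zero_le k) with rfl | rfl
  · obtain rfl := (hall l hl hlen).resolve_left hpos
    exact hk.resolve_left hkpos.ne
  · obtain rfl := (hall l hl hlen).resolve_right hpos
    exact hk.resolve_right hkpos.ne

theorem exists_adj_rep_eq_self {v : M.V} (hv : M.rep v = v) : ∃ w, M.Adj v w ∧ M.rep w = w := by
  obtain ⟨l₁, l₂, hne, h₁, hl₁, h₂, hl₂, -, hall⟩ := M.rep_two v
  rw [hv] at h₁ h₂ hall
  have hnil : IsWalkFrom M.Adj v v [] := isWalkFrom_nil.mpr rfl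
  obtain ⟨l, hl, hlen, hlne, huniq⟩ : ∃ l, IsWalkFrom M.Adj v v l ∧ l.length ≤ k ∧ l ≠ [] ∧
      ∀ m, IsWalkFrom M.Adj v v m → m.length ≤ k → m ≠ [] → m = l := by
    rcases hall [] hnil (Nat.zero_le k) with h | h
    · exact ⟨l₂, h₂, hl₂, fun h' => hne (h.symm.trans h'.symm), fun m hm hmk hm0 =>
        (hall m hm hmk).resolve_left fun h' => hm0 (h'.trans h.symm)⟩
    · exact ⟨l₁, h₁, hl₁, fun h' => hne (h'.trans h), fun m hm hmk hm0 =>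
        (hall m hm hmk).resolve_right fun h' => hm0 (h'.trans h.symm)⟩
  have hmap : l.map M.rep = l := by
    refine huniq _ ?_ (by simpa using hlen) (by simpa using hlne)
    have := (isWalkFrom_map M.rep_bijective.injective (fun u w => (M.rep_adj u w).symm)).mpr hl
    rwa [hv] at this
  cases l with
  | nil => exact absurd rfl hlne
  | cons x l => exact ⟨x, (isWalkFrom_cons.mp hl).1, (List.cons.inj hmap).1⟩

theorem iterate_rep_adj (n : ℕ) (u w : M.V) :
    M.Adj (M.rep^[n] u) (M.rep^[n] w) ↔ M.Adj u w := by
  induction n with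
  | zero => rfl
  | succ n ih => rw [Function.iterate_succ_apply', Function.iterate_succ_apply', ← M.rep_adj, ih]

/-- A self-repeat has an out-neighbour which is a self-repeat and another one which is fixed by
a power of the repeat map, of exponent less than the degree. -/
theorem exists_adj_ne_iterate_rep_eq_self {v : M.V} (hv : M.rep v = v) :
    ∃ x y n, M.Adj v x ∧ M.Adj v y ∧ x ≠ y ∧ 0 < n ∧ n ≤ d - 1 ∧ M.rep x = x ∧
      M.rep^[n] y = y := by
  obtain ⟨x, hx, hxrep⟩ := M.exists_adj_rep_eq_self hv
  have hcard : ({w | M.Adj v w} \ {x}).ncard = d - 1 := by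
    rw [Set.ncard_sdiff_singleton_of_mem (s := {w | M.Adj v w}) hx, M.out_deg]
  have hne : ({w | M.Adj v w} \ {x}).Nonempty := by
    rw [← Set.ncard_pos, hcard]
    have := M.hd
    omega
  obtain ⟨y, hy, hyx⟩ := hne
  have hxit : ∀ i, M.rep^[i] x = x := fun i => Function.iterate_fixed hxrep i
  have hvit : ∀ i, M.rep^[i] v = v := fun i => Function.iterate_fixed hv i
  refine ⟨x, y, Function.minimalPeriod M.rep y, hx, hy, Ne.symm hyx, ?_, ?_, hxrep,
    Function.iterate_minimalPeriod⟩
  · exact Function.minimalPeriod_pos_of_mem_periodicPts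
      (M.rep_bijective.injective.mem_periodicPts y)
  · rw [← hcard, ← Finset.card_range (Function.minimalPeriod M.rep y), ← Set.ncard_coe_finset]
    refine Set.ncard_le_ncard_of_injOn (fun i => M.rep^[i] y) (fun i _ => ⟨?_, ?_⟩) ?_
    · have := (M.iterate_rep_adj i v y).mpr hy
      rwa [hvit] at this
    · intro h
      refine hyx (M.rep_bijective.injective.iterate i ?_)
      rw [hxit]
      exact h
    · rw [Finset.coe_range]
      exact Function.iterate_injOn_Iio_minimalPeriod

end AlmostMooreDigraph

/-- For `d ≥ 6`, there do not exist almost Moore digraphs of degree `d`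
and diameter `k` with self-repeats whenever either `k` is odd with `k ≥ 2(d−1)`, or `k`
is even with `k ≥ 2(d−1)²`. -/
theorem stmt17 (d k : ℕ) (hd : 6 ≤ d)
    (h : (Odd k ∧ 2 * (d - 1) ≤ k) ∨ (Even k ∧ 2 * (d - 1) ^ 2 ≤ k)) :
    ¬ ∃ M : AlmostMooreDigraph d k, ∃ v : M.V, M.rep v = v := by
  rintro ⟨M, v, hv⟩
  obtain ⟨x, y, n, hx, hy, hxy, hn, hnd, hxrep, hyrep⟩ := M.exists_adj_ne_iterate_rep_eq_self hv
  obtain ⟨l, s, hs, hlk, hcop, hlt⟩ := exists_dvd_coprime_mul_lt hd h hnd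
  have hk : 3 ≤ k := by
    rcases h with ⟨-, h⟩ | ⟨-, h⟩
    · omega
    · have : 5 ≤ d - 1 := by omega
      nlinarith
  have hinj : Function.Injective (M.rep^[n]) := M.rep_bijective.injective.iterate n
  let π : Equiv.Perm M.V := Equiv.ofBijective M.rep M.rep_bijective
  let σ : Equiv.Perm {u // M.rep^[n] u = u} := π.subtypePerm fun u => by
    change M.rep^[n] (M.rep u) = M.rep u ↔ _
    rw [← Function.iterate_succ_apply, Function.iterate_succ_apply',
      M.rep_bijective.injective.eq_iff]
  have hσ : ∀ u, (σ u : M.V) = M.rep u := fun u => rfl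
  let A : {u // M.rep^[n] u = u} → {u // M.rep^[n] u = u} → Prop := fun u w => M.Adj u w
  have : DecidableRel A := fun u w => inferInstanceAs (Decidable (M.Adj u w))
  have hval : ∀ {u w : {u // M.rep^[n] u = u}} {m : List {u // M.rep^[n] u = u}},
      IsWalkFrom M.Adj u w (m.map Subtype.val) ↔ IsWalkFrom A u w m :=
    isWalkFrom_map Subtype.val_injective fun _ _ => Iff.rfl
  have hvalinj : Function.Injective (List.map (Subtype.val : {u // M.rep^[n] u = u} → M.V)) :=
    List.map_injective_iff.mpr Subtype.val_injective
  have hmap : ∀ {u w : {u // M.rep^[n] u = u}} {m : List M.V}, IsWalkFrom M.Adj u w m →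
      IsWalkFrom M.Adj u w (m.map M.rep^[n]) := fun {u w m} hm => by
    have := (isWalkFrom_map hinj (M.iterate_rep_adj n)).mpr hm
    rwa [u.2, w.2] at this
  refine Matrix.not_sum_pow_of_coprime (A := Matrix.of fun u w => if A u w then (1 : ℤ) else 0)
    (σ := σ) (v₀ := ⟨v, Function.iterate_fixed hv n⟩) hn hk ?_ ?_ ?_ ?_ ?_ ?_ ?_ ?_ hs hlk hcop hlt
  · have hit : ∀ (i : ℕ) u, ((σ ^ i) u : M.V) = M.rep^[i] u := fun i u => by
      induction i with
      | zero => rfl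
      | succ i ih => rw [pow_succ', Equiv.Perm.mul_apply, hσ, ih, Function.iterate_succ_apply']
    ext u
    rw [hit, u.2]
    rfl
  · intro u w
    rw [Matrix.of_apply]
    split_ifs <;> simp
  · intro u w
    have : A (σ u) (σ w) ↔ A u w := (M.rep_adj u w).symm
    simp only [Matrix.of_apply, this]
  · intro u w hw
    obtain ⟨F, hF, hcard⟩ := exists_finset_walk_length_le A k u w
    obtain ⟨m, ⟨hm, hmk⟩, huniq⟩ := M.rep_spec u w fun h => hw (Subtype.ext h)
    obtain ⟨m, rfl⟩ := List.exists_map_val_of_map_eq_self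
      (huniq (m.map M.rep^[n]) ⟨hmap hm, by simpa using hmk⟩)
    have hFm : F = {m} := by
      ext m'
      rw [hF, Finset.mem_singleton]
      constructor
      · rintro ⟨h1, h2⟩
        exact hvalinj (huniq _ ⟨hval.mpr h1, by simpa using h2⟩)
      · rintro rfl
        exact ⟨hval.mp hm, by simpa using hmk⟩
    rw [← hcard, hFm]
    simp
  · intro u
    obtain ⟨F, hF, hcard⟩ := exists_finset_walk_length_le A k u (σ u)
    rw [← hcard]
    obtain ⟨m₁, m₂, hne, h₁, hk₁, h₂, hk₂, -, hall⟩ := M.rep_two u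
    have hall' : ∀ m, IsWalkFrom A u (σ u) m → m.length ≤ k →
        m.map Subtype.val = m₁ ∨ m.map Subtype.val = m₂ := fun m hm hmk =>
      hall _ (hval.mpr hm) (by simpa using hmk)
    have hmapinj : Function.Injective (List.map M.rep^[n]) := List.map_injective_iff.mpr hinj
    rcases hall _ (hmap (w := σ u) h₁) (by simpa using hk₁) with h | h
    · right
      have h' : m₂.map M.rep^[n] = m₂ :=
        (hall _ (hmap (w := σ u) h₂) (by simpa using hk₂)).resolve_left
          fun h' => hne (hmapinj (h.trans h'.symm))
      obtain ⟨m₁, rfl⟩ := List.exists_map_val_of_map_eq_self h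
      obtain ⟨m₂, rfl⟩ := List.exists_map_val_of_map_eq_self h'
      have hFm : F = {m₁, m₂} := by
        ext m
        rw [hF, Finset.mem_insert, Finset.mem_singleton]
        constructor
        · rintro ⟨hm, hmk⟩
          exact (hall' m hm hmk).imp (fun h => hvalinj h) (fun h => hvalinj h)
        · rintro (rfl | rfl)
          · exact ⟨(hval (w := σ u)).mp h₁, by simpa using hk₁⟩
          · exact ⟨(hval (w := σ u)).mp h₂, by simpa using hk₂⟩
      rw [hFm, Finset.card_pair fun h => hne (by rw [h])]
      rfl
    · left
      have hFm : F = ∅ := by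
        refine Finset.eq_empty_of_forall_notMem fun m hm => hne ?_
        obtain ⟨hm, hmk⟩ := (hF m).mp hm
        have hfix := List.map_map_val_fixed m
        rcases hall' m hm hmk with h' | h' <;> rw [h'] at hfix
        · exact hfix.symm.trans h
        · exact hmapinj (h.trans hfix.symm)
      rw [hFm]
      rfl
  · intro i hi hik u
    obtain ⟨F, hF, hcard⟩ := exists_finset_walk_length_eq A i u u
    have hFm : F = ∅ := by
      refine Finset.eq_empty_of_forall_notMem fun m hm => ?_
      obtain ⟨hm, hlen⟩ := (hF m).mp hm
      have := (M.length_eq_of_closed_walk (hval.mpr hm)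
        (fun h => by
          rw [List.map_eq_nil_iff] at h
          rw [h, List.length_nil] at hlen
          omega)
        (by rw [List.length_map]; omega)).1
      rw [List.length_map] at this
      omega
    rw [← hcard, hFm]
    rfl
  · exact Subtype.ext hv
  · have hxS : M.rep^[n] x = x := Function.iterate_fixed hxrep n
    have hne : (⟨x, hxS⟩ : {u // M.rep^[n] u = u}) ≠ ⟨y, hyrep⟩ := fun h =>
      hxy (congrArg Subtype.val h)
    refine le_trans (le_of_eq ?_) (Finset.sum_le_sum_of_subset_of_nonneg
      (s := {⟨x, hxS⟩, ⟨y, hyrep⟩}) (Finset.subset_univ _) fun w _ _ => ?_)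
    · rw [Finset.sum_pair hne]
      simp [A, hx, hy]
    · rw [Matrix.of_apply]
      split_ifs <;> simp
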